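/- arXiv:2512.05757 — 2 statements merged into one kernel-verified Lean document; each statement's English description precedes it below -/
import Mathlib

section
/- Let m and p be positive integers, let B be a symmetric positive definite real m×m matrix, and let H be a real p×m matrix. Then the function h(R) = Tr((B + Hᵀ R⁻¹ H)⁻¹) is concave on the convex set of symmetric positive definite real p×p matrices; that is, for all symmetric positive definite R₁, R₂ and all λ ∈ [0,1], h(λR₁ + (1−λ)R₂) ≥ λ h(R₁) + (1−λ) h(R₂). -/
open Matrix

section JosephForm

variable {m p : Type*} [Fintype m] [Fintype p] [DecidableEq p]

theorem Matrix.PosDef.add_transpose_mul_inv_mul {B : Matrix m m ℝ} (hB : B.PosDef)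
    {R : Matrix p p ℝ} (hR : R.PosDef) (H : Matrix p m ℝ) : (B + Hᵀ * R⁻¹ * H).PosDef := by
  have h := hR.inv.posSemidef.conjTranspose_mul_mul_same H
  rw [conjTranspose_eq_transpose_of_trivial] at h
  exact hB.add_posSemidef h

variable [DecidableEq m]

/-- Completion of the square for the Joseph form
`(1 - K H) B⁻¹ (1 - K H)ᵀ + K R Kᵀ` as a function of the gain `K`. -/
theorem Matrix.PosDef.joseph_form_eq {B : Matrix m m ℝ} (hB : B.PosDef)
    {R : Matrix p p ℝ} (hR : R.PosDef) (H : Matrix p m ℝ) (K : Matrix m p ℝ) :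
    (1 - K * H) * B⁻¹ * (1 - K * H)ᵀ + K * R * Kᵀ =
      (B + Hᵀ * R⁻¹ * H)⁻¹ +
        (K - (B + Hᵀ * R⁻¹ * H)⁻¹ * Hᵀ * R⁻¹) * (H * B⁻¹ * Hᵀ + R) *
          (K - (B + Hᵀ * R⁻¹ * H)⁻¹ * Hᵀ * R⁻¹)ᵀ := by
  have hS := hB.add_transpose_mul_inv_mul hR H
  set S := B + Hᵀ * R⁻¹ * H with hS_def
  set L := S⁻¹ * Hᵀ * R⁻¹ with hL
  set W := H * B⁻¹ * Hᵀ + R with hW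
  have hBt : (B⁻¹)ᵀ = B⁻¹ := by
    simpa [conjTranspose_eq_transpose_of_trivial] using hB.inv.isHermitian.eq
  have hRt : Rᵀ = R := by
    simpa [conjTranspose_eq_transpose_of_trivial] using hR.isHermitian.eq
  have hWt : Wᵀ = W := by
    simp only [hW, transpose_add, transpose_mul, transpose_transpose, hBt, hRt, Matrix.mul_assoc]
  have hBB : B * B⁻¹ = 1 := mul_nonsing_inv B ((isUnit_iff_isUnit_det B).mp hB.isUnit)
  have hRR : R⁻¹ * R = 1 := nonsing_inv_mul R ((isUnit_iff_isUnit_det R).mp hR.isUnit)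
  have hSS : S⁻¹ * S = 1 := nonsing_inv_mul S ((isUnit_iff_isUnit_det S).mp hS.isUnit)
  have hP : S⁻¹ + L * H * B⁻¹ = B⁻¹ := by
    calc S⁻¹ + L * H * B⁻¹ = S⁻¹ * (B * B⁻¹) + L * H * B⁻¹ := by rw [hBB, Matrix.mul_one]
      _ = (S⁻¹ * S) * B⁻¹ := by
        rw [hL, hS_def]
        simp only [Matrix.mul_add, Matrix.add_mul, Matrix.mul_assoc]
      _ = B⁻¹ := by rw [hSS, Matrix.one_mul]
  have hLW : L * W = B⁻¹ * Hᵀ := by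
    calc L * W = L * H * B⁻¹ * Hᵀ + S⁻¹ * Hᵀ * (R⁻¹ * R) := by
          rw [hW, hL]
          simp only [Matrix.mul_add, Matrix.mul_assoc]
      _ = (S⁻¹ + L * H * B⁻¹) * Hᵀ := by rw [hRR, Matrix.mul_one, Matrix.add_mul, add_comm]
      _ = B⁻¹ * Hᵀ := by rw [hP]
  have hWL : W * Lᵀ = H * B⁻¹ := by
    simpa only [transpose_mul, transpose_transpose, hWt, hBt] using congrArg (fun M => Mᵀ) hLW
  have hsq : (K - L) * W * (K - L)ᵀ =
      K * W * Kᵀ - K * (H * B⁻¹) - B⁻¹ * Hᵀ * Kᵀ + L * H * B⁻¹ := by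
    rw [transpose_sub, Matrix.mul_sub, Matrix.sub_mul, Matrix.sub_mul, Matrix.sub_mul, hLW,
      Matrix.mul_assoc K W Lᵀ, hWL, ← hLW, Matrix.mul_assoc L W Lᵀ, hWL, Matrix.mul_assoc L H]
    abel
  rw [hsq, eq_sub_of_add_eq hP, hW]
  simp only [transpose_sub, transpose_one, transpose_mul, Matrix.mul_add, Matrix.add_mul,
    Matrix.mul_sub, Matrix.sub_mul, Matrix.mul_one, Matrix.one_mul, Matrix.mul_assoc]
  abel

theorem Matrix.PosDef.trace_inv_add_transpose_mul_inv_mul_le {B : Matrix m m ℝ} (hB : B.PosDef)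
    {R : Matrix p p ℝ} (hR : R.PosDef) (H : Matrix p m ℝ) (K : Matrix m p ℝ) :
    ((B + Hᵀ * R⁻¹ * H)⁻¹).trace ≤
      ((1 - K * H) * B⁻¹ * (1 - K * H)ᵀ).trace + (K * R * Kᵀ).trace := by
  have hW := (hB.inv.posSemidef.mul_mul_conjTranspose_same H).add hR.posSemidef
  have h := (hW.mul_mul_conjTranspose_same (K - (B + Hᵀ * R⁻¹ * H)⁻¹ * Hᵀ * R⁻¹)).trace_nonneg
  simp only [conjTranspose_eq_transpose_of_trivial] at h
  rw [← trace_add, hB.joseph_form_eq hR H K, trace_add]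
  exact le_add_of_nonneg_right h

end JosephForm

/-- Proposition 1: `h(R) = Tr((B + Hᵀ R⁻¹ H)⁻¹)` is concave on the set of
symmetric positive definite real `p × p` matrices. -/
theorem stmt_0 (m p : ℕ) (hm : 0 < m) (hp : 0 < p)
    (B : Matrix (Fin m) (Fin m) ℝ) (hB : B.PosDef)
    (H : Matrix (Fin p) (Fin m) ℝ)
    (R₁ R₂ : Matrix (Fin p) (Fin p) ℝ) (hR₁ : R₁.PosDef) (hR₂ : R₂.PosDef)
    (l : ℝ) (hl0 : 0 ≤ l) (hl1 : l ≤ 1) :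
    l * ((B + Hᵀ * R₁⁻¹ * H)⁻¹).trace + (1 - l) * ((B + Hᵀ * R₂⁻¹ * H)⁻¹).trace ≤
      ((B + Hᵀ * (l • R₁ + (1 - l) • R₂)⁻¹ * H)⁻¹).trace := by
  have hR : (l • R₁ + (1 - l) • R₂).PosDef := by
    rcases hl0.eq_or_lt with rfl | hl
    · simpa using hR₂
    · exact (hR₁.smul hl).add_posSemidef (hR₂.posSemidef.smul (sub_nonneg.mpr hl1))
  set R := l • R₁ + (1 - l) • R₂ with hR_def
  set K := (B + Hᵀ * R⁻¹ * H)⁻¹ * Hᵀ * R⁻¹ with hK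
  have h₁ := hB.trace_inv_add_transpose_mul_inv_mul_le hR₁ H K
  have h₂ := hB.trace_inv_add_transpose_mul_inv_mul_le hR₂ H K
  have h := congrArg trace (hB.joseph_form_eq hR H K)
  rw [← hK, sub_self, Matrix.zero_mul, Matrix.zero_mul, add_zero, trace_add] at h
  have hlin : (K * R * Kᵀ).trace =
      l * (K * R₁ * Kᵀ).trace + (1 - l) * (K * R₂ * Kᵀ).trace := by
    simp only [hR_def, Matrix.mul_add, Matrix.add_mul, Matrix.mul_smul, Matrix.smul_mul,
      trace_add, trace_smul, smul_eq_mul]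
  rw [← h, hlin]
  linarith [mul_le_mul_of_nonneg_left h₁ hl0,
    mul_le_mul_of_nonneg_left h₂ (sub_nonneg.mpr hl1)]
end

section
/- Let E be a type, S a subset of E, and f : E → ℝ bounded below on S. Let x : ℕ → E be a sequence with x i ∈ S for all i, and let u : ℕ → E → ℝ be a sequence of surrogate functions satisfying, for every i: (a) f y ≤ u i y for all y ∈ S (majorization), (b) u i (x i) = f (x i) (tightness at the current iterate), and (c) u i (x (i+1)) ≤ u i (x i) (the next iterate does not increase the surrogate). Then f (x (i+1)) ≤ f (x i) for every i, and the sequence i ↦ f (x i) converges to a finite limit. -/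
/-- Proposition 3 (abstract descent principle of majorization–minimization):
if `f` is bounded below on `S`, the iterates stay in `S`, and the surrogates
`u i` majorize `f` on `S`, are tight at `x i`, and are not increased by the
next iterate, then `f (x i)` is nonincreasing and converges to a finite limit. -/
theorem stmt_13 {E : Type*} (S : Set E) (f : E → ℝ)
    (hbdd : ∃ m : ℝ, ∀ y ∈ S, m ≤ f y)
    (x : ℕ → E) (hx : ∀ i, x i ∈ S)
    (u : ℕ → E → ℝ)
    (hmaj : ∀ i, ∀ y ∈ S, f y ≤ u i y)
    (htight : ∀ i, u i (x i) = f (x i))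
    (hdec : ∀ i, u i (x (i + 1)) ≤ u i (x i)) :
    (∀ i, f (x (i + 1)) ≤ f (x i)) ∧
    ∃ L : ℝ, Filter.Tendsto (fun i => f (x i)) Filter.atTop (nhds L) := by
  have hstep (i : ℕ) : f (x (i + 1)) ≤ f (x i) :=
    (hmaj i _ (hx (i + 1))).trans ((hdec i).trans_eq (htight i))
  obtain ⟨m, hm⟩ := hbdd
  exact ⟨hstep, _, tendsto_atTop_ciInf (antitone_nat_of_succ_le hstep)
    ⟨m, Set.forall_mem_range.2 fun i => hm _ (hx i)⟩⟩
end
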